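/- Let H1 and H2 be complex Hilbert spaces with H1 nontrivial, let T : H1 → H2 be a bounded linear operator, and let F_T := T ∘ (I + T*T)^{−1/2} be its bounded transform. Then m(F_T) = m(T)/√(1 + m(T)²). -/

import Mathlib

open ContinuousLinearMap

variable {H1 H2 : Type*} [NormedAddCommGroup H1] [InnerProductSpace ℂ H1] [CompleteSpace H1]
  [NormedAddCommGroup H2] [InnerProductSpace ℂ H2] [CompleteSpace H2]

/-- The minimum modulus of a bounded operator. -/
noncomputable def mB (T : H1 →L[ℂ] H2) : ℝ :=
  sInf {r : ℝ | ∃ x : H1, ‖x‖ = 1 ∧ ‖T x‖ = r}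

/-- The bounded transform `F_T = T ∘ (I + T*T)^{-1/2}` of `T`, where
`(I + T*T)^{-1/2}` is given by the continuous functional calculus applied to `T*T`. -/
noncomputable def boundedTransform (T : H1 →L[ℂ] H2) : H1 →L[ℂ] H2 :=
  T ∘L cfc (fun t : ℝ => (Real.sqrt (1 + t))⁻¹) (adjoint T ∘L T)

omit [CompleteSpace H1] [CompleteSpace H2] in
theorem mB_le (T : H1 →L[ℂ] H2) {x : H1} (hx : ‖x‖ = 1) : mB T ≤ ‖T x‖ :=
  csInf_le ⟨0, by rintro r ⟨y, -, rfl⟩; exact norm_nonneg _⟩ ⟨x, hx, rfl⟩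

omit [CompleteSpace H1] [CompleteSpace H2] in
theorem mB_nonneg (T : H1 →L[ℂ] H2) : 0 ≤ mB T :=
  Real.sInf_nonneg (by rintro r ⟨y, -, rfl⟩; exact norm_nonneg _)

omit [CompleteSpace H1] [CompleteSpace H2] in
theorem mB_mul_norm_le (T : H1 →L[ℂ] H2) (x : H1) : mB T * ‖x‖ ≤ ‖T x‖ := by
  rcases eq_or_ne x 0 with rfl | hx
  · simp
  have hx' : 0 < ‖x‖ := norm_pos_iff.mpr hx
  have h := mB_le T (norm_smul_inv_norm (𝕜 := ℂ) hx)
  rw [map_smul, norm_smul, norm_inv, RCLike.norm_ofReal, abs_norm,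
    inv_mul_eq_div, le_div_iff₀ hx'] at h
  exact h

theorem spectrum_adjoint_comp_self_nonneg (T : H1 →L[ℂ] H2) {t : ℝ}
    (ht : t ∈ spectrum ℝ (adjoint T ∘L T)) : 0 ≤ t :=
  spectrum_nonneg_of_nonneg
    ((nonneg_iff_isPositive _).mpr (isPositive_adjoint_comp_self T)) ht

/-- The operator `(I + T*T)^{1/2}` is inverse to `(I + T*T)^{-1/2}`, and its norm is the graph
norm of `T`. -/
theorem exists_sqrt_one_add_adjoint_comp_self (T : H1 →L[ℂ] H2) :
    ∃ R : H1 →L[ℂ] H1,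
      (∀ x, cfc (fun t : ℝ => (Real.sqrt (1 + t))⁻¹) (adjoint T ∘L T) (R x) = x) ∧
      (∀ x, R (cfc (fun t : ℝ => (Real.sqrt (1 + t))⁻¹) (adjoint T ∘L T) x) = x) ∧
      ∀ x, ‖R x‖ ^ 2 = ‖x‖ ^ 2 + ‖T x‖ ^ 2 := by
  set A : H1 →L[ℂ] H1 := adjoint T ∘L T with hA
  have hsa : IsSelfAdjoint A := (isPositive_adjoint_comp_self T).isSelfAdjoint
  have hpos : ∀ t ∈ spectrum ℝ A, 0 < Real.sqrt (1 + t) := fun t ht =>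
    Real.sqrt_pos.mpr (by linarith [spectrum_adjoint_comp_self_nonneg T ht])
  have hc : ContinuousOn (fun t : ℝ => Real.sqrt (1 + t)) (spectrum ℝ A) := by fun_prop
  have hci : ContinuousOn (fun t : ℝ => (Real.sqrt (1 + t))⁻¹) (spectrum ℝ A) :=
    hc.inv₀ fun t ht => (hpos t ht).ne'
  set R := cfc (fun t : ℝ => Real.sqrt (1 + t)) A with hR
  have hSR : cfc (fun t : ℝ => (Real.sqrt (1 + t))⁻¹) A * R = 1 := by
    rw [hR, ← cfc_mul _ _ A hci hc, ← cfc_one ℝ A]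
    exact cfc_congr fun t ht => inv_mul_cancel₀ (hpos t ht).ne'
  have hRS : R * cfc (fun t : ℝ => (Real.sqrt (1 + t))⁻¹) A = 1 := by
    rw [hR, ← cfc_mul _ _ A hc hci, ← cfc_one ℝ A]
    exact cfc_congr fun t ht => mul_inv_cancel₀ (hpos t ht).ne'
  have hRR : R * R = 1 + A := by
    calc R * R = cfc (fun t : ℝ => 1 + t) A := by
          rw [hR, ← cfc_mul _ _ A hc hc]
          exact cfc_congr fun t ht =>
            Real.mul_self_sqrt (by linarith [spectrum_adjoint_comp_self_nonneg T ht])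
      _ = 1 + A := by rw [cfc_const_add (1 : ℝ) (fun t => t) A, cfc_id' ℝ A, map_one]
  have hRsa : adjoint R = R := (cfc_predicate (fun t : ℝ => Real.sqrt (1 + t)) A).adjoint_eq
  refine ⟨R, fun x => congr($hSR x), fun x => congr($hRS x), fun x => ?_⟩
  have h : inner ℂ (R x) (R x) = inner ℂ x x + inner ℂ (T x) (T x) := by
    rw [← adjoint_inner_right R, hRsa, show R (R x) = x + A x from congr($hRR x),
      inner_add_right, hA, comp_apply, adjoint_inner_right]
  simp only [inner_self_eq_norm_sq_to_K] at h
  exact_mod_cast h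

theorem min_modulus_boundedTransform [Nontrivial H1] (T : H1 →L[ℂ] H2) :
    mB (boundedTransform T) = mB T / Real.sqrt (1 + (mB T) ^ 2) := by
  obtain ⟨R, hSR, hRS, hR⟩ := exists_sqrt_one_add_adjoint_comp_self T
  have hm := mB_nonneg T
  obtain ⟨u, hu⟩ := exists_norm_eq H1 zero_le_one
  apply le_antisymm
  · have hclosed : IsClosed {s : ℝ | mB (boundedTransform T) ≤ s / Real.sqrt (1 + s ^ 2)} :=
      isClosed_le continuous_const <| continuous_id.div (by fun_prop) fun s =>
        (Real.sqrt_pos.mpr (by positivity)).ne'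
    refine closure_minimal ?_ hclosed (csInf_mem_closure ⟨‖T u‖, u, hu, rfl⟩
      ⟨0, by rintro r ⟨y, -, rfl⟩; exact norm_nonneg _⟩)
    rintro s ⟨x, hx, rfl⟩
    have hRx : ‖R x‖ = Real.sqrt (1 + ‖T x‖ ^ 2) := by
      rw [← Real.sqrt_sq (norm_nonneg (R x)), hR, hx, one_pow]
    have h := mB_mul_norm_le (boundedTransform T) (R x)
    rw [boundedTransform, comp_apply, hSR, ← boundedTransform, hRx] at h
    exact (le_div_iff₀ (Real.sqrt_pos.mpr (by positivity))).mpr h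
  · refine le_csInf ⟨_, u, hu, rfl⟩ ?_
    rintro r ⟨x, hx, rfl⟩
    rw [boundedTransform, comp_apply]
    set y := cfc (fun t : ℝ => (Real.sqrt (1 + t))⁻¹) (adjoint T ∘L T) x
    have hy : 1 = ‖y‖ ^ 2 + ‖T y‖ ^ 2 := by rw [← hR, hRS, hx, one_pow]
    have hle : (mB T * ‖y‖) ^ 2 ≤ ‖T y‖ ^ 2 :=
      pow_le_pow_left₀ (by positivity) (mB_mul_norm_le T y) 2
    rw [div_le_iff₀ (Real.sqrt_pos.mpr (by positivity))]
    refine (sq_le_sq₀ hm (by positivity)).mp ?_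
    rw [mul_pow, Real.sq_sqrt (by positivity)]
    linear_combination hle + mB T ^ 2 * hy
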